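/- arXiv:2006.02336 — 3 statements merged into one kernel-verified Lean document; each statement's English description precedes it below -/
import Mathlib

section
/- Let d₁ ≥ d₂ ≥ … ≥ d_T be real numbers, m₁,…,m_T real numbers such that for every 1 ≤ j ≤ T the sum of the j largest values among m₁,…,m_T is at most d₁ + … + dⱼ, and let q₁ > q₂ > … > q_T > 0 be strictly decreasing positive weights. Then Σ_{j=1}^{T} qⱼ mⱼ = Σ_{j=1}^{T} qⱼ dⱼ holds if and only if mⱼ = dⱼ for every 1 ≤ j ≤ T. -/
open Finset BigOperators

theorem abel_aux (T : ℕ) (e q : ℕ → ℝ) (hq : ∀ n < T, q (n + 1) < q n)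
    (hE : ∀ n ≤ T, 0 ≤ ∑ i ∈ range n, e i) (n : ℕ) (hn : n ≤ T) :
    0 ≤ ∑ i ∈ range n, q i * e i - q n * ∑ i ∈ range n, e i ∧
    (∑ i ∈ range n, q i * e i - q n * ∑ i ∈ range n, e i = 0 →
      ∀ k ≤ n, ∑ i ∈ range k, e i = 0) := by
  induction n with
  | zero =>
    refine ⟨by simp, fun _ k hk => ?_⟩
    obtain rfl : k = 0 := by omega
    simp
  | succ n ih =>
    obtain ⟨h1, h2⟩ := ih (by omega)
    have hqn := hq n (by omega)
    have hEn := hE (n + 1) hn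
    have key : ∑ i ∈ range (n + 1), q i * e i - q (n + 1) * ∑ i ∈ range (n + 1), e i
        = (∑ i ∈ range n, q i * e i - q n * ∑ i ∈ range n, e i)
          + (q n - q (n + 1)) * ∑ i ∈ range (n + 1), e i := by
      rw [sum_range_succ, sum_range_succ e]; ring
    have hp : 0 ≤ (q n - q (n + 1)) * ∑ i ∈ range (n + 1), e i :=
      mul_nonneg (by linarith) hEn
    rw [key]
    refine ⟨by linarith, fun h k hk => ?_⟩
    rcases Nat.lt_or_ge n k with hk' | hk'
    · obtain rfl : k = n + 1 := by omega
      have h0 : (q n - q (n + 1)) * ∑ i ∈ range (n + 1), e i = 0 := by linarith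
      rcases mul_eq_zero.mp h0 with h0 | h0
      · linarith
      · exact h0
    · exact h2 (by linarith) k hk'

/-- If `d` is nonincreasing and, for every `j`, the sum of the `j` largest values among the
`m t` (equivalently, the sum of `m` over any subset of size `j`) is at most `d₁ + ⋯ + dⱼ`,
then for strictly decreasing positive weights `q`, `∑ j, q j * m j = ∑ j, q j * d j` holds
if and only if `m j = d j` for every `j`. -/
theorem stmt_6 {T : ℕ} (d m : Fin T → ℝ) (hd : Antitone d)
    (hm : ∀ s : Finset (Fin T),
      ∑ t ∈ s, m t ≤ ∑ t ∈ Finset.univ.filter (fun t : Fin T => (t : ℕ) < s.card), d t)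
    (q : Fin T → ℝ) (hq : StrictAnti q) (hq0 : ∀ j, 0 < q j) :
    ∑ j, q j * m j = ∑ j, q j * d j ↔ ∀ j, m j = d j := by
  refine ⟨fun h => ?_, fun h => by simp [h]⟩
  set e : ℕ → ℝ := fun n => if hn : n < T then d ⟨n, hn⟩ - m ⟨n, hn⟩ else 0 with he
  set p : ℕ → ℝ := fun n => if hn : n < T then q ⟨n, hn⟩ else 0 with hp
  have hee : ∀ j : Fin T, e j = d j - m j := fun j => by simp [he]
  have hpp : ∀ j : Fin T, p j = q j := fun j => by simp [hp]
  have hpq : ∀ n < T, p (n + 1) < p n := by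
    intro n hn
    by_cases h' : n + 1 < T
    · simp only [hp, hn, h', dif_pos]
      exact hq (by simp [Fin.lt_def])
    · simp only [hp, hn, h', dif_pos, dif_neg, not_false_eq_true]
      exact hq0 _
  have hE : ∀ n ≤ T, 0 ≤ ∑ i ∈ range n, e i := by
    intro n hn
    have hs : ∑ i ∈ range n, e i
        = ∑ t ∈ Finset.univ.filter (fun t : Fin T => (t : ℕ) < n), (d t - m t) := by
      symm
      refine Finset.sum_bij (fun t _ => (t : ℕ)) ?_ ?_ ?_ ?_
      · intro t ht; simpa using ht
      · intro a _ b _ hab; exact Fin.ext hab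
      · intro b hb
        have hb' : b < n := by simpa using hb
        exact ⟨⟨b, by omega⟩, by simpa using hb', rfl⟩
      · intro t _; exact (hee t).symm
    have hc : (Finset.univ.filter (fun t : Fin T => (t : ℕ) < n)).card = n := by
      rw [Fin.card_filter_val_lt]; omega
    have := hm (Finset.univ.filter (fun t : Fin T => (t : ℕ) < n))
    rw [hc] at this
    rw [hs, sum_sub_distrib]; linarith
  have hS : ∑ i ∈ range T, p i * e i = 0 := by
    rw [Finset.sum_range]
    simp only [hee, hpp, mul_sub, sum_sub_distrib]
    linarith
  have hpT : p T = 0 := by simp [hp]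
  have hz := (abel_aux T e p hpq hE T le_rfl).2 (by rw [hS, hpT]; ring)
  intro j
  have h1 := hz (j + 1) j.2
  rw [sum_range_succ, hz j j.2.le, hee] at h1
  linarith
end

section
/- Let d₁ ≥ … ≥ d_T ≥ 0 and m₁ ≥ … ≥ m_T ≥ 0 be real numbers such that Σ_{j=1}^{ℓ} mⱼ ≤ Σ_{j=1}^{ℓ} dⱼ for every 1 ≤ ℓ ≤ T. Then Σ_{j=1}^{T} (dⱼ − mⱼ)² ≤ Σ_{j=1}^{T} dⱼ² − Σ_{j=1}^{T} mⱼ². -/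
open Finset BigOperators

theorem abel_aux_s9 (m e : ℕ → ℝ) (hm : Antitone m) (T : ℕ)
    (h : ∀ l ≤ T, 0 ≤ ∑ j ∈ range l, e j) :
    m T * ∑ j ∈ range T, e j ≤ ∑ j ∈ range T, m j * e j := by
  induction T with
  | zero => simp
  | succ n ih =>
    have h1 := ih (fun l hl => h l (by omega))
    have h2 := h (n + 1) le_rfl
    have h3 := mul_le_mul_of_nonneg_right (hm (Nat.le_succ n)) h2
    refine h3.trans ?_
    rw [sum_range_succ, sum_range_succ, mul_add]
    linarith

/-- If `d₁ ≥ ⋯ ≥ d_T ≥ 0` and `m₁ ≥ ⋯ ≥ m_T ≥ 0` with the partial sums of `m` dominated by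
those of `d` (weak majorization), then `∑ j, (d j - m j)² ≤ ∑ j, d j² - ∑ j, m j²`. -/
theorem stmt_9 {T : ℕ} (d m : Fin T → ℝ) (hd : Antitone d) (hm : Antitone m)
    (hd0 : ∀ j, 0 ≤ d j) (hm0 : ∀ j, 0 ≤ m j)
    (hmaj : ∀ l : ℕ, l ≤ T →
      ∑ j ∈ Finset.univ.filter (fun j : Fin T => (j : ℕ) < l), m j ≤
        ∑ j ∈ Finset.univ.filter (fun j : Fin T => (j : ℕ) < l), d j) :
    ∑ j, (d j - m j) ^ 2 ≤ ∑ j, d j ^ 2 - ∑ j, m j ^ 2 := by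
  let M : ℕ → ℝ := fun i => if h : i < T then m ⟨i, h⟩ else 0
  let E : ℕ → ℝ := fun i => if h : i < T then d ⟨i, h⟩ - m ⟨i, h⟩ else 0
  have hM : ∀ j : Fin T, M j = m j := fun j => by simp [M]
  have hE : ∀ j : Fin T, E j = d j - m j := fun j => by simp [E]
  have hMa : Antitone M := by
    intro a b hab
    by_cases hb : b < T
    · have ha : a < T := by omega
      simpa [M, ha, hb] using hm (show (⟨a, ha⟩ : Fin T) ≤ ⟨b, hb⟩ from hab)
    · by_cases ha : a < T
      · simpa [M, ha, hb] using hm0 _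
      · simp [M, ha, hb]
  have hS : ∀ l ≤ T, 0 ≤ ∑ j ∈ range l, E j := by
    intro l hl
    have h1 : ∑ j ∈ range l, E j
        = ∑ j ∈ Finset.univ.filter (fun j : Fin T => (j : ℕ) < l), (d j - m j) := by
      rw [sum_filter]
      simp_rw [← hE]
      rw [Fin.sum_univ_eq_sum_range (fun i => if i < l then E i else 0) T, ← sum_filter]
      congr 1
      ext i
      simp only [mem_range, mem_filter]
      omega
    rw [h1, sum_sub_distrib]
    linarith [hmaj l hl]
  have key := abel_aux_s9 M E hMa T hS
  have hMT : M T = 0 := by simp [M]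
  rw [hMT, zero_mul, ← Fin.sum_univ_eq_sum_range (fun i => M i * E i) T] at key
  simp_rw [hM, hE] at key
  have h2 : ∑ j, d j ^ 2 - ∑ j, m j ^ 2 - ∑ j, (d j - m j) ^ 2
      = 2 * ∑ j, m j * (d j - m j) := by
    rw [mul_sum, ← sum_sub_distrib, ← sum_sub_distrib]
    exact sum_congr rfl fun j _ => by ring
  linarith
end

section
/- (Ky Fan maximum principle) Let A be a Hermitian complex n×n matrix with eigenvalues λ₁ ≥ λ₂ ≥ … ≥ λₙ (counted with multiplicity), and let f₁,…,f_k be orthonormal vectors in ℂⁿ. Then Σ_{j=1}^{k} ⟨fⱼ, A fⱼ⟩ ≤ Σ_{j=1}^{k} λⱼ. -/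
open Matrix BigOperators

noncomputable section

theorem kyfan_weights {k m : ℕ} (lam w : Fin (k + m) → ℝ) (hlam : Antitone lam)
    (h0 : ∀ i, 0 ≤ w i) (h1 : ∀ i, w i ≤ 1) (hs : ∑ i, w i = k) :
    ∑ i, lam i * w i ≤ ∑ j : Fin k, lam (Fin.castAdd m j) := by
  rcases Nat.eq_zero_or_pos k with rfl | hk
  · have : ∀ i, w i = 0 := by
      intro i
      have := (Finset.sum_eq_zero_iff_of_nonneg (fun i _ => h0 i)).1 (by simpa using hs)
      exact this i (Finset.mem_univ i)
    simp [this]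
  · set μ := lam (Fin.castAdd m ⟨k - 1, by omega⟩) with hμ
    have e : ∑ i, lam i * w i = ∑ i, (lam i - μ) * w i + μ * k := by
      rw [← hs, Finset.mul_sum, ← Finset.sum_add_distrib]
      exact Finset.sum_congr rfl fun i _ => by ring
    have a1 : ∑ j : Fin k, (lam (Fin.castAdd m j) - μ) * w (Fin.castAdd m j)
        ≤ ∑ j : Fin k, (lam (Fin.castAdd m j) - μ) := by
      refine Finset.sum_le_sum fun j _ => ?_
      have : μ ≤ lam (Fin.castAdd m j) := hlam (by
        rw [Fin.le_def]; simp only [Fin.val_castAdd]; omega)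
      nlinarith [h1 (Fin.castAdd m j)]
    have a2 : ∑ j : Fin m, (lam (Fin.natAdd k j) - μ) * w (Fin.natAdd k j) ≤ 0 := by
      refine Finset.sum_nonpos fun j _ => ?_
      have : lam (Fin.natAdd k j) ≤ μ := hlam (by
        rw [Fin.le_def]; simp only [Fin.val_castAdd, Fin.val_natAdd]; omega)
      nlinarith [h0 (Fin.natAdd k j)]
    rw [e, Fin.sum_univ_add]
    rw [Finset.sum_sub_distrib] at a1
    simp only [Finset.sum_const, Finset.card_univ, Fintype.card_fin, nsmul_eq_mul] at a1
    linarith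

theorem kyfan_quad {n : ℕ} (A : Matrix (Fin n) (Fin n) ℂ) (hA : A.IsHermitian)
    (x : Fin n → ℂ) :
    (star x ⬝ᵥ A.mulVec x).re = ∑ i, hA.eigenvalues i *
      ‖inner ℂ (hA.eigenvectorBasis i) (WithLp.toLp 2 x : EuclideanSpace ℂ (Fin n))‖ ^ 2 := by
  set X : EuclideanSpace ℂ (Fin n) := WithLp.toLp 2 x with hX
  set Y : EuclideanSpace ℂ (Fin n) := WithLp.toLp 2 (A *ᵥ x) with hY
  have h1 : star x ⬝ᵥ A.mulVec x = inner ℂ X Y := by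
    rw [EuclideanSpace.inner_eq_star_dotProduct, dotProduct_comm]
  have h2 : ∀ i, inner ℂ (hA.eigenvectorBasis i) Y
      = (hA.eigenvalues i : ℂ) * inner ℂ (hA.eigenvectorBasis i) X := by
    intro i
    rw [EuclideanSpace.inner_eq_star_dotProduct, EuclideanSpace.inner_eq_star_dotProduct,
      dotProduct_comm, dotProduct_comm X.ofLp]
    change star _ ⬝ᵥ (A *ᵥ x) = _ * (star _ ⬝ᵥ x)
    have h3 : ∀ v : Fin n → ℂ, star v ᵥ* A = star (A *ᵥ v) := fun v => by
      rw [star_mulVec, hA.eq]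
    rw [dotProduct_mulVec, h3, hA.mulVec_eigenvectorBasis]
    simp [star_smul, smul_dotProduct]
  rw [h1, ← hA.eigenvectorBasis.sum_inner_mul_inner, Complex.re_sum]
  refine Finset.sum_congr rfl fun i _ => ?_
  rw [h2, ← inner_conj_symm X, mul_left_comm, mul_comm (starRingEnd ℂ _), Complex.mul_conj,
    ← Complex.ofReal_mul, Complex.ofReal_re, Complex.normSq_eq_norm_sq]

/-- Ky Fan maximum principle: if `A` is Hermitian with eigenvalues `lam 0 ≥ ⋯ ≥ lam (n-1)`
(counted with multiplicity, i.e. up to a permutation they are Mathlib's eigenvalues of `A`),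
then for any orthonormal family `f` of `k` vectors, `∑ j, ⟨f j, A (f j)⟩ ≤ ∑_{j<k} lam j`. -/
theorem stmt_12 {n k : ℕ} (hk : k ≤ n)
    (A : Matrix (Fin n) (Fin n) ℂ) (hA : A.IsHermitian)
    (lam : Fin n → ℝ) (hlam : Antitone lam)
    (hspec : ∃ σ : Equiv.Perm (Fin n), ∀ i, lam i = hA.eigenvalues (σ i))
    (f : Fin k → (Fin n → ℂ))
    (hf : ∀ i j, star (f i) ⬝ᵥ f j = if i = j then 1 else 0) :
    ∑ j, (star (f j) ⬝ᵥ A.mulVec (f j)).re ≤ ∑ j : Fin k, lam (Fin.castLE hk j) := by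
  obtain ⟨σ, hσ⟩ := hspec
  obtain ⟨m, rfl⟩ := Nat.exists_eq_add_of_le hk
  let F : Fin k → EuclideanSpace ℂ (Fin (k + m)) := fun j => WithLp.toLp 2 (f j)
  have hF : Orthonormal ℂ F := by
    rw [orthonormal_iff_ite]
    intro i j
    rw [EuclideanSpace.inner_eq_star_dotProduct, dotProduct_comm]
    exact hf i j
  let b := hA.eigenvectorBasis
  let w : Fin (k + m) → ℝ := fun i => ∑ j, ‖inner ℂ (b (σ i)) (F j)‖ ^ 2
  have key := kyfan_weights lam w hlam (fun i => Finset.sum_nonneg fun j _ => by positivity)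
    (fun i => by
      have := hF.sum_inner_products_le (b (σ i)) (s := Finset.univ)
      rw [b.orthonormal.1, one_pow] at this
      refine le_trans (le_of_eq ?_) this
      exact Finset.sum_congr rfl fun j _ => by rw [norm_inner_symm])
    (by
      simp only [w]
      rw [Finset.sum_comm]
      have : ∀ j, ∑ i, ‖inner ℂ (b (σ i)) (F j)‖ ^ 2 = 1 := by
        intro j
        rw [Equiv.sum_comp σ (fun i => ‖inner ℂ (b i) (F j)‖ ^ 2), b.sum_sq_norm_inner_right,
          hF.1, one_pow]
      simp [this])
  refine le_trans (le_of_eq ?_) key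
  simp only [w, Finset.mul_sum]
  rw [Finset.sum_comm]
  refine Finset.sum_congr rfl fun j _ => ?_
  rw [kyfan_quad A hA (f j), ← Equiv.sum_comp σ]
  exact Finset.sum_congr rfl fun i _ => by rw [hσ]
end
end
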